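/- Let A be a symmetric positive definite real 3×3 matrix, u ∈ ℝ³ a unit vector, γ > 0. Let Ā := (1/2)(tr(A)I₃ − A), and let λ_m^Ā and λ_M^Ā denote its smallest and largest eigenvalues. Set α₁ := max{7(λ_M^Ā)²/λ_m^Ā, 6γ}. Then for all R ∈ SO(3) and θ ∈ ℝ: ‖ψ(A·T(R,θ))‖² + (γθ + 2uᵀψ(A·T(R,θ)))² ≤ α₁ · U(R,θ). -/

import Mathlib

open Matrix

noncomputable section

abbrev M3 : Type := Matrix (Fin 3) (Fin 3) ℝ
abbrev V3 : Type := Fin 3 → ℝ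

/-- skew-symmetric matrix associated to `x`: `skew x *ᵥ y = x ×₃ y`. -/
def skew (x : V3) : M3 :=
  !![0, -x 2, x 1; x 2, 0, -x 0; -x 1, x 0, 0]

/-- the special orthogonal group SO(3) as a subset of 3×3 matrices -/
def SO3 : Set M3 := {R | Rᵀ * R = 1 ∧ R.det = 1}

/-- Rodrigues formula -/
def Ra (θ : ℝ) (u : V3) : M3 :=
  1 + Real.sin θ • skew u + (1 - Real.cos θ) • (skew u * skew u)

/-- `psi M = vec (P_a M)`, the vector part of the antisymmetric projection -/
def psi (M : M3) : V3 :=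
  ![(M 2 1 - M 1 2) / 2, (M 0 2 - M 2 0) / 2, (M 1 0 - M 0 1) / 2]

/-- the angular-warping transformation `T(R,θ) = R · Ra(θ,u)` -/
def Tmap (u : V3) (R : M3) (θ : ℝ) : M3 := R * Ra θ u

/-- the potential function `U(R,θ)` on SO(3) × ℝ -/
def Ufun (A : M3) (u : V3) (γ : ℝ) (R : M3) (θ : ℝ) : ℝ :=
  (A * (1 - Tmap u R θ)).trace + γ / 2 * θ ^ 2

/-- Euclidean norm on ℝ³ -/
def enorm3 (x : V3) : ℝ := Real.sqrt (x ⬝ᵥ x)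

/-- Frobenius norm of a 3×3 matrix -/
def fnorm (M : M3) : ℝ := Real.sqrt ((Mᵀ * M).trace)

/-- `E(M) := (tr(M) I − Mᵀ)/2` -/
def Emap (M : M3) : M3 := (2⁻¹ : ℝ) • (M.trace • (1 : M3) - Mᵀ)

/-- `D_R(R,θ)` from Lemma 2 -/
def DR (A : M3) (u : V3) (R : M3) (θ : ℝ) : M3 :=
  Ra θ u * Emap (A * Tmap u R θ) * (Ra θ u)ᵀ

/-- `D_θ(R,θ)` from Lemma 2 -/
def Dθ (A : M3) (u : V3) (R : M3) (θ : ℝ) : V3 :=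
  (Ra θ u * Emap (A * Tmap u R θ)) *ᵥ u - skew (Ra θ u *ᵥ psi (A * Tmap u R θ)) *ᵥ u

/-- Δ(v,u) from the construction of the synergistic gap -/
def Delta (A : M3) (v u : V3) : ℝ :=
  u ⬝ᵥ ((A.trace • (1 : M3) - A - (2 * (v ⬝ᵥ A *ᵥ v)) • ((1 : M3) - vecMulVec v v)) *ᵥ u)

/-- `v` is a unit eigenvector of `A` -/
def IsUnitEigen (A : M3) (v : V3) : Prop :=
  v ⬝ᵥ v = 1 ∧ ∃ lam : ℝ, A *ᵥ v = lam • v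

/-- Ā := (tr(A) I − A)/2 -/
def Abar (A : M3) : M3 := (2⁻¹ : ℝ) • (A.trace • (1 : M3) - A)

/-- `lam` is an eigenvalue of `M` -/
def IsEigen (M : M3) (lam : ℝ) : Prop := ∃ w : V3, w ≠ 0 ∧ M *ᵥ w = lam • w

theorem dotProduct_three (x y : V3) : x ⬝ᵥ y = x 0 * y 0 + x 1 * y 1 + x 2 * y 2 := by
  simp [dotProduct, Fin.sum_univ_three]

theorem sq_dotProduct_le (x y : V3) : (x ⬝ᵥ y) ^ 2 ≤ (x ⬝ᵥ x) * (y ⬝ᵥ y) := by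
  simp only [dotProduct_three]
  nlinarith [sq_nonneg (x 0 * y 1 - x 1 * y 0), sq_nonneg (x 0 * y 2 - x 2 * y 0),
    sq_nonneg (x 1 * y 2 - x 2 * y 1)]

theorem skew_transpose (x : V3) : (skew x)ᵀ = -skew x := by
  ext i j
  fin_cases i <;> fin_cases j <;> simp [skew]

theorem skew_mul_skew_mul_skew (x : V3) :
    skew x * skew x * skew x = -(x ⬝ᵥ x) • skew x := by
  ext i j
  fin_cases i <;> fin_cases j <;>
    simp [skew, dotProduct_three, Matrix.mul_apply, Fin.sum_univ_three] <;> ring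

theorem det_one_add_skew (x : V3) (s c : ℝ) :
    (1 + s • skew x + c • (skew x * skew x)).det =
      (1 - c * (x ⬝ᵥ x)) ^ 2 + s ^ 2 * (x ⬝ᵥ x) := by
  simp [Matrix.det_fin_three, skew, dotProduct_three]
  ring

theorem Ra_mem_SO3 (θ : ℝ) {u : V3} (hu : u ⬝ᵥ u = 1) : Ra θ u ∈ SO3 := by
  have hsc := Real.sin_sq_add_cos_sq θ
  constructor
  · have h3 : skew u * skew u * skew u = -skew u := by
      rw [skew_mul_skew_mul_skew, hu]; simp
    have h4 : skew u * skew u * (skew u * skew u) = -(skew u * skew u) := by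
      rw [← mul_assoc, h3, neg_mul]
    have h3' : skew u * (skew u * skew u) = -skew u := by rw [← mul_assoc, h3]
    have hT : (Ra θ u)ᵀ =
        1 - Real.sin θ • skew u + (1 - Real.cos θ) • (skew u * skew u) := by
      simp [Ra, Matrix.transpose_add, Matrix.transpose_mul, skew_transpose, sub_eq_add_neg]
    rw [hT, Ra]
    simp only [mul_add, add_mul, sub_mul, one_mul, mul_one, smul_mul_assoc, mul_smul_comm,
      h3, h4, h3']
    match_scalars <;> first | ring1 | linear_combination -hsc
  · rw [Ra, det_one_add_skew, hu]
    linear_combination hsc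

theorem mul_mem_SO3 {R S : M3} (hR : R ∈ SO3) (hS : S ∈ SO3) : R * S ∈ SO3 := by
  refine ⟨?_, by rw [Matrix.det_mul, hR.2, hS.2, one_mul]⟩
  rw [Matrix.transpose_mul, mul_assoc, ← mul_assoc Rᵀ, hR.1, one_mul, hS.1]

/-- Every rotation matrix comes from a unit quaternion. -/
theorem exists_quaternion_of_mem_SO3 {T : M3} (hT : T ∈ SO3) :
    ∃ (η : ℝ) (ε : V3), η ^ 2 + ε ⬝ᵥ ε = 1 ∧
      T = 1 + (2 * η) • skew ε + (2 : ℝ) • (skew ε * skew ε) := by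
  obtain ⟨h1, hdet⟩ := hT
  have h2 : T * Tᵀ = 1 := mul_eq_one_comm.mp h1
  have hadj : T.adjugate = Tᵀ := by
    calc T.adjugate = Tᵀ * (T * T.adjugate) := by rw [← mul_assoc, h1, one_mul]
      _ = Tᵀ := by rw [Matrix.mul_adjugate, hdet, one_smul, mul_one]
  rw [Matrix.adjugate_fin_three] at hadj
  have e1 := fun i j => congrFun (congrFun h1 i) j
  have e2 := fun i j => congrFun (congrFun h2 i) j
  have e3 := fun i j => congrFun (congrFun hadj i) j
  simp [Fin.forall_fin_succ, Matrix.mul_apply, Fin.sum_univ_three] at e1 e2 e3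
  obtain ⟨⟨a1, a2, a3⟩, ⟨a4, a5, a6⟩, a7, a8, a9⟩ := e1
  obtain ⟨⟨b1, b2, b3⟩, ⟨b4, b5, b6⟩, b7, b8, b9⟩ := e2
  obtain ⟨⟨c1, c2, c3⟩, ⟨c4, c5, c6⟩, c7, c8, c9⟩ := e3
  suffices ∃ p x y z : ℝ, 4 * p ^ 2 = 1 + T 0 0 + T 1 1 + T 2 2 ∧
      4 * x ^ 2 = 1 + T 0 0 - T 1 1 - T 2 2 ∧ 4 * y ^ 2 = 1 - T 0 0 + T 1 1 - T 2 2 ∧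
      4 * z ^ 2 = 1 - T 0 0 - T 1 1 + T 2 2 ∧
      4 * (p * x) = T 2 1 - T 1 2 ∧ 4 * (p * y) = T 0 2 - T 2 0 ∧ 4 * (p * z) = T 1 0 - T 0 1 ∧
      4 * (x * y) = T 0 1 + T 1 0 ∧ 4 * (x * z) = T 0 2 + T 2 0 ∧ 4 * (y * z) = T 1 2 + T 2 1 by
    obtain ⟨p, x, y, z, k1, k2, k3, k4, k5, k6, k7, k8, k9, k10⟩ := this
    refine ⟨p, ![x, y, z], ?_, ?_⟩
    · simp; linarith
    · ext i j
      fin_cases i <;> fin_cases j <;>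
        simp [skew] <;> linarith
  have key : ∀ k : ℝ, 0 < k →
      ∃ t : ℝ, ∀ v w m : ℝ, v * w = k * m → 4 * (t * v * (t * w)) = m := by
    intro k hk
    refine ⟨(2 * √k)⁻¹, fun v w m h => ?_⟩
    have hs : √k ^ 2 = k := Real.sq_sqrt hk.le
    have hs0 : √k ≠ 0 := (Real.sqrt_pos.mpr hk).ne'
    field_simp
    rw [hs]
    linarith
  have hpos : 0 < 1 + T 0 0 + T 1 1 + T 2 2 ∨ 0 < 1 + T 0 0 - T 1 1 - T 2 2 ∨
      0 < 1 - T 0 0 + T 1 1 - T 2 2 ∨ 0 < 1 - T 0 0 - T 1 1 + T 2 2 := by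
    by_contra! h
    linarith [h.1, h.2.1, h.2.2.1, h.2.2.2]
  rcases hpos with hk | hk | hk | hk
  · obtain ⟨t, ht⟩ := key _ hk
    refine ⟨t * (1 + T 0 0 + T 1 1 + T 2 2), t * (T 2 1 - T 1 2), t * (T 0 2 - T 2 0),
      t * (T 1 0 - T 0 1), ?_⟩
    simp only [pow_two]
    refine ⟨?_, ?_, ?_, ?_, ?_, ?_, ?_, ?_, ?_, ?_⟩ <;> apply ht <;> linarith
  · obtain ⟨t, ht⟩ := key _ hk
    refine ⟨t * (T 2 1 - T 1 2), t * (1 + T 0 0 - T 1 1 - T 2 2), t * (T 0 1 + T 1 0),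
      t * (T 0 2 + T 2 0), ?_⟩
    simp only [pow_two]
    refine ⟨?_, ?_, ?_, ?_, ?_, ?_, ?_, ?_, ?_, ?_⟩ <;> apply ht <;> linarith
  · obtain ⟨t, ht⟩ := key _ hk
    refine ⟨t * (T 0 2 - T 2 0), t * (T 0 1 + T 1 0), t * (1 - T 0 0 + T 1 1 - T 2 2),
      t * (T 1 2 + T 2 1), ?_⟩
    simp only [pow_two]
    refine ⟨?_, ?_, ?_, ?_, ?_, ?_, ?_, ?_, ?_, ?_⟩ <;> apply ht <;> linarith
  · obtain ⟨t, ht⟩ := key _ hk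
    refine ⟨t * (T 1 0 - T 0 1), t * (T 0 2 + T 2 0), t * (T 1 2 + T 2 1),
      t * (1 - T 0 0 - T 1 1 + T 2 2), ?_⟩
    simp only [pow_two]
    refine ⟨?_, ?_, ?_, ?_, ?_, ?_, ?_, ?_, ?_, ?_⟩ <;> apply ht <;> linarith

theorem psi_dotProduct_psi {A : M3} (hA : Aᵀ = A) (η : ℝ) (ε : V3) (h : η ^ 2 + ε ⬝ᵥ ε = 1) :
    psi (A * (1 + (2 * η) • skew ε + (2 : ℝ) • (skew ε * skew ε))) ⬝ᵥ
      psi (A * (1 + (2 * η) • skew ε + (2 : ℝ) • (skew ε * skew ε))) =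
      4 * ((Abar A *ᵥ ε) ⬝ᵥ (Abar A *ᵥ ε)) - 4 * (ε ⬝ᵥ Abar A *ᵥ ε) ^ 2 := by
  have h10 : A 1 0 = A 0 1 := congrFun (congrFun hA 0) 1
  have h20 : A 2 0 = A 0 2 := congrFun (congrFun hA 0) 2
  have h21 : A 2 1 = A 1 2 := congrFun (congrFun hA 1) 2
  set y := Abar A *ᵥ ε with hy
  have hpsi : psi (A * (1 + (2 * η) • skew ε + (2 : ℝ) • (skew ε * skew ε))) =
      ![2 * (η * y 0 - (ε 1 * y 2 - ε 2 * y 1)), 2 * (η * y 1 - (ε 2 * y 0 - ε 0 * y 2)),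
        2 * (η * y 2 - (ε 0 * y 1 - ε 1 * y 0))] := by
    ext i
    fin_cases i <;>
      simp [hy, psi, skew, Abar, Matrix.mul_apply, Matrix.mulVec, dotProduct_three,
        Fin.sum_univ_three, Matrix.trace, h10, h20, h21] <;> ring
  rw [hpsi]
  simp only [dotProduct_three] at h ⊢
  simp
  linear_combination 4 * (y 0 ^ 2 + y 1 ^ 2 + y 2 ^ 2) * h

theorem trace_mul_one_sub {A : M3} (hA : Aᵀ = A) (η : ℝ) (ε : V3) :
    (A * (1 - (1 + (2 * η) • skew ε + (2 : ℝ) • (skew ε * skew ε)))).trace =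
      4 * (ε ⬝ᵥ Abar A *ᵥ ε) := by
  have h10 : A 1 0 = A 0 1 := congrFun (congrFun hA 0) 1
  have h20 : A 2 0 = A 0 2 := congrFun (congrFun hA 0) 2
  have h21 : A 2 1 = A 1 2 := congrFun (congrFun hA 1) 2
  simp [skew, Abar, Matrix.mul_apply, Matrix.mulVec, dotProduct_three,
    Fin.sum_univ_three, Matrix.trace, h10, h20, h21]
  ring

theorem Abar_posDef {A : M3} (hA : A.PosDef) : (Abar A).PosDef := by
  have hAT : Aᵀ = A := by simpa using hA.isHermitian.eq
  refine Matrix.PosDef.of_dotProduct_mulVec_pos ?_ ?_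
  · simp [Matrix.IsHermitian, Abar, Matrix.conjTranspose_eq_transpose_of_trivial, hAT]
  · intro w hw
    have hq : ∀ x : V3, 0 ≤ x ⬝ᵥ A *ᵥ x := fun x => by
      simpa using hA.posSemidef.dotProduct_mulVec_nonneg x
    have hp : ∀ x : V3, x ≠ 0 → 0 < x ⬝ᵥ A *ᵥ x := fun x hx => by
      simpa using hA.dotProduct_mulVec_pos hx
    have hsum : 2 * (star w ⬝ᵥ Abar A *ᵥ w) = ![0, -w 2, w 1] ⬝ᵥ A *ᵥ ![0, -w 2, w 1] +
        ![w 2, 0, -w 0] ⬝ᵥ A *ᵥ ![w 2, 0, -w 0] +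
        ![-w 1, w 0, 0] ⬝ᵥ A *ᵥ ![-w 1, w 0, 0] := by
      simp only [Matrix.mulVec, dotProduct_three]
      simp [Abar, Matrix.trace, Fin.sum_univ_three]
      ring
    have q1 := hq ![0, -w 2, w 1]
    have q2 := hq ![w 2, 0, -w 0]
    have q3 := hq ![-w 1, w 0, 0]
    by_cases h : ![0, -w 2, w 1] = 0
    · have h2 : w 2 = 0 := by simpa using congrFun h 1
      have h1 : w 1 = 0 := by simpa using congrFun h 2
      have h0 : w 0 ≠ 0 := by
        intro h0
        apply hw
        ext i
        fin_cases i <;> simp [h0, h1, h2]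
      have := hp ![w 2, 0, -w 0] fun h' => h0 (by simpa using congrFun h' 2)
      linarith
    · have := hp _ h
      linarith

/-- If all eigenvalues of `B` are at most `c`, then `B² ≤ c B` as quadratic forms. -/
theorem mulVec_dotProduct_mulVec_le {B : M3} (hB : B.PosDef) {c : ℝ}
    (hc : ∀ lam : ℝ, IsEigen B lam → lam ≤ c) (hc0 : 0 < c) (x : V3) :
    (B *ᵥ x) ⬝ᵥ (B *ᵥ x) ≤ c * (x ⬝ᵥ B *ᵥ x) := by
  have hBT : Bᵀ = B := by simpa using hB.isHermitian.eq
  have hherm : (c • (1 : M3) - B).IsHermitian := by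
    simp [Matrix.IsHermitian, Matrix.conjTranspose_eq_transpose_of_trivial, hBT]
  have hpsd : (c • (1 : M3) - B).PosSemidef := by
    rw [hherm.posSemidef_iff_eigenvalues_nonneg]
    intro i
    have hv := hherm.mulVec_eigenvectorBasis i
    have hne := hherm.eigenvectorBasis.toBasis.ne_zero i
    rw [OrthonormalBasis.coe_toBasis] at hne
    have : c - hherm.eigenvalues i ≤ c := by
      refine hc _ ⟨⇑(hherm.eigenvectorBasis i), fun h => hne (by ext j; exact congrFun h j), ?_⟩
      rw [Matrix.sub_mulVec, Matrix.smul_mulVec, Matrix.one_mulVec] at hv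
      rw [sub_smul, ← hv]
      simp
    simpa using this
  have p1 := hpsd.dotProduct_mulVec_nonneg (B *ᵥ x)
  have p2 := hB.posSemidef.dotProduct_mulVec_nonneg (c • x - B *ᵥ x)
  have hs : x ⬝ᵥ B *ᵥ (B *ᵥ x) = (B *ᵥ x) ⬝ᵥ (B *ᵥ x) := by
    rw [Matrix.dotProduct_mulVec, ← Matrix.mulVec_transpose, hBT]
  simp only [star_trivial, Matrix.sub_mulVec, Matrix.smul_mulVec, Matrix.one_mulVec,
    Matrix.mulVec_sub, Matrix.mulVec_smul, dotProduct_sub, sub_dotProduct, dotProduct_smul,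
    smul_dotProduct, smul_eq_mul, hs] at p1 p2
  nlinarith

theorem gradient_upper_bound
    (A : M3) (hA : A.PosDef) (u : V3) (hu : u ⬝ᵥ u = 1) (γ : ℝ) (hγ : 0 < γ)
    (lamm lamM : ℝ) (hm : IsEigen (Abar A) lamm) (hM : IsEigen (Abar A) lamM)
    (hbound : ∀ lam : ℝ, IsEigen (Abar A) lam → lamm ≤ lam ∧ lam ≤ lamM)
    (α1 : ℝ) (hα1 : α1 = max (7 * lamM ^ 2 / lamm) (6 * γ)) :
    ∀ R ∈ SO3, ∀ θ : ℝ,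
      psi (A * Tmap u R θ) ⬝ᵥ psi (A * Tmap u R θ) +
        (γ * θ + 2 * (u ⬝ᵥ psi (A * Tmap u R θ))) ^ 2 ≤ α1 * Ufun A u γ R θ := by
  intro R hR θ
  have hpd := Abar_posDef hA
  have hAT : Aᵀ = A := by simpa using hA.isHermitian.eq
  have hlm : 0 < lamm := by
    obtain ⟨w, hw, hw'⟩ := hm
    have h1 := hpd.dotProduct_mulVec_pos hw
    rw [hw', star_trivial, dotProduct_smul, smul_eq_mul] at h1
    have h2 : 0 ≤ w ⬝ᵥ w := by
      rw [dotProduct_three]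
      nlinarith [sq_nonneg (w 0), sq_nonneg (w 1), sq_nonneg (w 2)]
    exact pos_of_mul_pos_left h1 h2
  have hmM : lamm ≤ lamM := (hbound _ hm).2
  have hlM : 0 < lamM := hlm.trans_le hmM
  obtain ⟨η, ε, hq, hT⟩ := exists_quaternion_of_mem_SO3 (mul_mem_SO3 hR (Ra_mem_SO3 θ hu))
  have hpsi := psi_dotProduct_psi hAT η ε hq
  have htr := trace_mul_one_sub hAT η ε
  have hle := mulVec_dotProduct_mulVec_le hpd (fun l hl => (hbound l hl).2) hlM ε
  have hV : 0 ≤ ε ⬝ᵥ Abar A *ᵥ ε := by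
    simpa using hpd.posSemidef.dotProduct_mulVec_nonneg ε
  rw [← hT] at hpsi htr
  have hcs := sq_dotProduct_le u (psi (A * (R * Ra θ u)))
  rw [hu, one_mul] at hcs
  simp only [Ufun, Tmap]
  rw [htr]
  set P := psi (A * (R * Ra θ u))
  set V := ε ⬝ᵥ Abar A *ᵥ ε
  have hPV : P ⬝ᵥ P ≤ 4 * (lamM * V) := by nlinarith [sq_nonneg V]
  have hα7 : 7 * lamM ≤ α1 := by
    rw [hα1]
    refine le_max_of_le_left ?_
    rw [le_div_iff₀ hlm]
    nlinarith
  have hα6 : 6 * γ ≤ α1 := hα1 ▸ le_max_right _ _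
  have hsq : (γ * θ + 2 * (u ⬝ᵥ P)) ^ 2 ≤ 3 * (γ * θ) ^ 2 + 6 * (u ⬝ᵥ P) ^ 2 := by
    nlinarith [sq_nonneg (γ * θ - u ⬝ᵥ P)]
  have t1 : 7 * lamM * (4 * V) ≤ α1 * (4 * V) := by gcongr
  have t2 : 6 * γ * (γ / 2 * θ ^ 2) ≤ α1 * (γ / 2 * θ ^ 2) := by gcongr
  nlinarith
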